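/- The stabilizer in O(4) of 𝒲'₂ = T₁ ∪ T₂ ∪ T' is exactly the subgroup generated by: (z₁,z₂) ↦ (z₁, iz₂); (z₁,z₂) ↦ (z̄₁, z̄₂); the rotation R_{C'₁}^{π/2} given by (z₁,z₂) ↦ ((z₁+z₂)/2 + i(z₁−z₂)/2, (z₁+z₂)/2 − i(z₁−z₂)/2); and (z₁,z₂) ↦ (e^{iα}z₁, e^{iα}z₂) for all α ∈ ℝ; and this group properly contains the stabilizer in O(4) of 𝒲₂. -/

import Mathlib

open Complex Real

/-- The real inner product on `ℂ × ℂ ≅ ℝ⁴`. -/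
noncomputable def realInner (p q : ℂ × ℂ) : ℝ :=
  (p.1 * (starRingEnd ℂ) q.1 + p.2 * (starRingEnd ℂ) q.2).re

/-- The Clifford torus `T₁ = {e^{iz}(cos r, sin r)}`. -/
def torusT1 : Set (ℂ × ℂ) :=
  {p | ∃ r z : ℝ,
    p = (Complex.exp (z * Complex.I) * (Real.cos r : ℂ),
         Complex.exp (z * Complex.I) * (Real.sin r : ℂ))}

/-- The Clifford torus `T₂ = {e^{iz}(cos r, i sin r)}`. -/
def torusT2 : Set (ℂ × ℂ) :=
  {p | ∃ r z : ℝ,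
    p = (Complex.exp (z * Complex.I) * (Real.cos r : ℂ),
         Complex.exp (z * Complex.I) * Complex.I * (Real.sin r : ℂ))}

/-- The Clifford torus `T' = {(e^{ix},e^{iy})/√2}`. -/
def cliffordT' : Set (ℂ × ℂ) :=
  {p | ∃ x y : ℝ,
    p = (Complex.exp (x * Complex.I) / (Real.sqrt 2 : ℂ),
         Complex.exp (y * Complex.I) / (Real.sqrt 2 : ℂ))}

/-- The generators: `(z₁,z₂) ↦ (z₁, i z₂)`; `(z₁,z₂) ↦ (z̄₁, z̄₂)`; the rotation
`R_{C'₁}^{π/2}`; and the simultaneous rotations `(z₁,z₂) ↦ (e^{iα}z₁, e^{iα}z₂)`. -/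
def genSetW'2 : Set ((ℂ × ℂ) ≃ₗ[ℝ] (ℂ × ℂ)) :=
  {A | (∀ z : ℂ × ℂ, A z = (z.1, Complex.I * z.2)) ∨
       (∀ z : ℂ × ℂ, A z = ((starRingEnd ℂ) z.1, (starRingEnd ℂ) z.2)) ∨
       (∀ z : ℂ × ℂ,
         A z = ((z.1 + z.2) / 2 + Complex.I * (z.1 - z.2) / 2,
                (z.1 + z.2) / 2 - Complex.I * (z.1 - z.2) / 2)) ∨
       (∃ α : ℝ, ∀ z : ℂ × ℂ,
         A z = (Complex.exp ((α : ℂ) * Complex.I) * z.1,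
                Complex.exp ((α : ℂ) * Complex.I) * z.2))}


/-- The three coordinates of the Hopf map `ℂ² → ℝ³`: `2 Re(z₁ z̄₂)`, `2 Im(z₁ z̄₂)` and
`|z₁|² - |z₂|²`. -/
noncomputable def hopf : Fin 3 → ℂ × ℂ → ℝ :=
  ![fun v => 2 * (v.1.re * v.2.re + v.1.im * v.2.im),
    fun v => 2 * (v.1.im * v.2.re - v.1.re * v.2.im),
    fun v => v.1.re ^ 2 + v.1.im ^ 2 - v.2.re ^ 2 - v.2.im ^ 2]

lemma hopf_zero (v : ℂ × ℂ) : hopf 0 v = 2 * (v.1.re * v.2.re + v.1.im * v.2.im) := rfl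

lemma hopf_one (v : ℂ × ℂ) : hopf 1 v = 2 * (v.1.im * v.2.re - v.1.re * v.2.im) := rfl

lemma hopf_two (v : ℂ × ℂ) :
    hopf 2 v = v.1.re ^ 2 + v.1.im ^ 2 - v.2.re ^ 2 - v.2.im ^ 2 := rfl

lemma fin_three_cases (i : Fin 3) : i = 0 ∨ i = 1 ∨ i = 2 := by
  fin_cases i <;> simp

/-- The squared Euclidean norm on `ℂ²`. -/
def sqNorm (v : ℂ × ℂ) : ℝ := v.1.re ^ 2 + v.1.im ^ 2 + v.2.re ^ 2 + v.2.im ^ 2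

lemma realInner_self (v : ℂ × ℂ) : realInner v v = sqNorm v := by
  simp [realInner, sqNorm]; ring

lemma sum_sq_hopf (v : ℂ × ℂ) :
    hopf 0 v ^ 2 + hopf 1 v ^ 2 + hopf 2 v ^ 2 = sqNorm v ^ 2 := by
  simp only [hopf_zero, hopf_one, hopf_two, sqNorm]; ring

lemma realInner_polarization (v w : ℂ × ℂ) :
    realInner v w = (sqNorm (v + w) - sqNorm v - sqNorm w) / 2 := by
  simp [realInner, sqNorm]; ring

lemma isometry_iff (A : (ℂ × ℂ) ≃ₗ[ℝ] (ℂ × ℂ)) :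
    (∀ v w, realInner (A v) (A w) = realInner v w) ↔ ∀ v, sqNorm (A v) = sqNorm v := by
  refine ⟨fun h v => by rw [← realInner_self, h, realInner_self], fun h v w => ?_⟩
  rw [realInner_polarization, realInner_polarization, ← map_add, h, h, h]

lemma hopf_smul (i : Fin 3) (t : ℝ) (v : ℂ × ℂ) : hopf i (t • v) = t ^ 2 * hopf i v := by
  obtain rfl | rfl | rfl := fin_three_cases i <;>
    simp [hopf_zero, hopf_one, hopf_two] <;> ring

lemma sqNorm_smul (t : ℝ) (v : ℂ × ℂ) : sqNorm (t • v) = t ^ 2 * sqNorm v := by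
  simp [sqNorm]; ring

lemma sqNorm_nonneg (v : ℂ × ℂ) : 0 ≤ sqNorm v := by unfold sqNorm; positivity

lemma eq_zero_of_sqNorm_eq_zero {v : ℂ × ℂ} (h : sqNorm v = 0) : v = 0 := by
  unfold sqNorm at h
  apply Prod.ext <;> apply Complex.ext <;>
    simp only [Prod.fst_zero, Prod.snd_zero, Complex.zero_re, Complex.zero_im] <;>
    nlinarith [sq_nonneg v.1.re, sq_nonneg v.1.im, sq_nonneg v.2.re, sq_nonneg v.2.im]

lemma exists_cos_sin {x y : ℝ} (h : x ^ 2 + y ^ 2 = 1) :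
    ∃ r : ℝ, Real.cos r = x ∧ Real.sin r = y := by
  have hn : ‖(⟨x, y⟩ : ℂ)‖ = 1 := by
    rw [Complex.norm_def, Complex.normSq_mk, Real.sqrt_eq_one]; linarith
  have hne : (⟨x, y⟩ : ℂ) ≠ 0 := by rw [← norm_ne_zero_iff, hn]; exact one_ne_zero
  exact ⟨Complex.arg ⟨x, y⟩, by rw [Complex.cos_arg hne, hn, div_one],
    by rw [Complex.sin_arg, hn, div_one]⟩

lemma re_exp_mul_I (x : ℝ) : (Complex.exp (x * Complex.I)).re = Real.cos x :=
  Complex.exp_ofReal_mul_I_re x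

lemma im_exp_mul_I (x : ℝ) : (Complex.exp (x * Complex.I)).im = Real.sin x :=
  Complex.exp_ofReal_mul_I_im x

/-- Polar coordinates, without division. -/
lemma exists_polar (a b : ℝ) : ∃ z ρ : ℝ, a = ρ * Real.cos z ∧ b = ρ * Real.sin z ∧
    ρ ^ 2 = a ^ 2 + b ^ 2 := by
  refine ⟨Complex.arg ⟨a, b⟩, ‖(⟨a, b⟩ : ℂ)‖, ?_, ?_, ?_⟩
  · rw [Complex.norm_mul_cos_arg]
  · rw [Complex.norm_mul_sin_arg]
  · rw [Complex.sq_norm, Complex.normSq_mk]; ring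

lemma mem_torusT1_iff (v : ℂ × ℂ) : v ∈ torusT1 ↔ sqNorm v = 1 ∧ hopf 1 v = 0 := by
  constructor
  · rintro ⟨r, z, rfl⟩
    simp only [sqNorm, hopf_one, Complex.re_mul_ofReal, Complex.im_mul_ofReal, re_exp_mul_I,
      im_exp_mul_I]
    constructor
    · linear_combination (Real.cos r ^ 2 + Real.sin r ^ 2) * Real.sin_sq_add_cos_sq z +
        Real.sin_sq_add_cos_sq r
    · ring
  · obtain ⟨⟨a, b⟩, ⟨c, d⟩⟩ := v
    simp only [sqNorm, hopf_one]
    rintro ⟨hn, hh⟩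
    obtain ⟨z, x, y, ha, hb, hc, hd⟩ : ∃ z x y : ℝ, a = x * Real.cos z ∧ b = x * Real.sin z ∧
        c = y * Real.cos z ∧ d = y * Real.sin z := by
      by_cases h0 : a ^ 2 + b ^ 2 = 0
      · obtain ⟨z, y, hc, hd, -⟩ := exists_polar c d
        exact ⟨z, 0, y, by nlinarith [sq_nonneg a, sq_nonneg b],
          by nlinarith [sq_nonneg a, sq_nonneg b], hc, hd⟩
      · obtain ⟨z, x, ha, hb, hx⟩ := exists_polar a b
        have hx0 : x ≠ 0 := by rintro rfl; exact h0 (by linarith)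
        have hz := Real.sin_sq_add_cos_sq z
        have hs : Real.sin z * c = Real.cos z * d := by
          apply mul_left_cancel₀ hx0
          rw [ha, hb] at hh
          linear_combination hh / 2
        refine ⟨z, x, c * Real.cos z + d * Real.sin z, ha, hb, ?_, ?_⟩
        · linear_combination -c * hz + Real.sin z * hs
        · linear_combination -d * hz - Real.cos z * hs
    obtain ⟨r, hr, hr'⟩ : ∃ r : ℝ, Real.cos r = x ∧ Real.sin r = y := by
      apply exists_cos_sin
      subst ha hb hc hd
      linear_combination hn - (x ^ 2 + y ^ 2) * Real.sin_sq_add_cos_sq z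
    refine ⟨r, z, ?_⟩
    apply Prod.ext <;> apply Complex.ext <;>
      simp only [Complex.re_mul_ofReal, Complex.im_mul_ofReal, re_exp_mul_I, im_exp_mul_I, hr, hr',
        ha, hb, hc, hd] <;> ring

lemma mem_torusT2_iff (v : ℂ × ℂ) : v ∈ torusT2 ↔ sqNorm v = 1 ∧ hopf 0 v = 0 := by
  have key : v ∈ torusT2 ↔ (v.1, -Complex.I * v.2) ∈ torusT1 := by
    simp only [torusT1, torusT2, Set.mem_ofPred_eq, Prod.ext_iff]
    refine exists₂_congr fun r z => and_congr_right fun _ => ⟨fun h => ?_, fun h => ?_⟩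
    · rw [h]
      linear_combination -(Complex.exp (z * Complex.I) * (Real.sin r : ℂ)) * Complex.I_mul_I
    · linear_combination Complex.I * h + v.2 * Complex.I_mul_I
  rw [key, mem_torusT1_iff]
  simp only [sqNorm, hopf_zero, hopf_one]
  simp
  constructor <;> rintro ⟨h, h'⟩ <;> constructor <;> linarith

lemma mem_cliffordT'_iff (v : ℂ × ℂ) : v ∈ cliffordT' ↔ sqNorm v = 1 ∧ hopf 2 v = 0 := by
  have h2 : (Real.sqrt 2) ^ 2 = 2 := Real.sq_sqrt (by norm_num)
  have h0 : Real.sqrt 2 ≠ 0 := by positivity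
  constructor
  · rintro ⟨x, y, rfl⟩
    simp only [sqNorm, hopf_two, Complex.div_ofReal_re, Complex.div_ofReal_im, re_exp_mul_I,
      im_exp_mul_I, div_pow, h2]
    constructor
    · linear_combination Real.sin_sq_add_cos_sq x / 2 + Real.sin_sq_add_cos_sq y / 2
    · linear_combination Real.sin_sq_add_cos_sq x / 2 - Real.sin_sq_add_cos_sq y / 2
  · obtain ⟨⟨a, b⟩, ⟨c, d⟩⟩ := v
    simp only [sqNorm, hopf_two]
    rintro ⟨hn, hh⟩
    obtain ⟨x, hx, hx'⟩ := exists_cos_sin (x := a * Real.sqrt 2) (y := b * Real.sqrt 2)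
      (by linear_combination (a ^ 2 + b ^ 2) * h2 + hn + hh)
    obtain ⟨y, hy, hy'⟩ := exists_cos_sin (x := c * Real.sqrt 2) (y := d * Real.sqrt 2)
      (by linear_combination (c ^ 2 + d ^ 2) * h2 + hn - hh)
    refine ⟨x, y, ?_⟩
    apply Prod.ext <;> apply Complex.ext <;>
      simp only [Complex.div_ofReal_re, Complex.div_ofReal_im, re_exp_mul_I, im_exp_mul_I,
        hx, hx', hy, hy'] <;> field_simp

lemma mem_W_iff (v : ℂ × ℂ) :
    v ∈ torusT1 ∪ torusT2 ↔ sqNorm v = 1 ∧ ∏ i ∈ {0, 1}, hopf i v = 0 := by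
  rw [Set.mem_union, mem_torusT1_iff, mem_torusT2_iff, Finset.prod_pair zero_ne_one, mul_eq_zero]
  tauto

lemma mem_W'_iff (v : ℂ × ℂ) : v ∈ torusT1 ∪ torusT2 ∪ cliffordT' ↔
    sqNorm v = 1 ∧ ∏ i, hopf i v = 0 := by
  rw [Set.mem_union, Set.mem_union, mem_torusT1_iff, mem_torusT2_iff, mem_cliffordT'_iff,
    Fin.prod_univ_three, mul_eq_zero, mul_eq_zero]
  tauto

/-- Rational parametrizations of the quadric cones `hopf i = 0`. -/
noncomputable def coneParam : Fin 3 → ℝ × ℝ × ℝ × ℝ → ℂ × ℂ :=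
  ![fun w => (⟨w.1 * w.2.2.1, w.2.1 * w.2.2.1⟩, ⟨-(w.2.1 * w.2.2.2), w.1 * w.2.2.2⟩),
    fun w => (⟨w.1 * w.2.2.1, w.2.1 * w.2.2.1⟩, ⟨w.1 * w.2.2.2, w.2.1 * w.2.2.2⟩),
    fun w => (⟨w.1 * w.2.2.1 - w.2.1 * w.2.2.2, w.1 * w.2.2.2 + w.2.1 * w.2.2.1⟩,
      ⟨w.1 * w.2.2.1 + w.2.1 * w.2.2.2, w.2.1 * w.2.2.1 - w.1 * w.2.2.2⟩)]

lemma coneParam_zero (w : ℝ × ℝ × ℝ × ℝ) : coneParam 0 w =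
    (⟨w.1 * w.2.2.1, w.2.1 * w.2.2.1⟩, ⟨-(w.2.1 * w.2.2.2), w.1 * w.2.2.2⟩) := rfl

lemma coneParam_one (w : ℝ × ℝ × ℝ × ℝ) : coneParam 1 w =
    (⟨w.1 * w.2.2.1, w.2.1 * w.2.2.1⟩, ⟨w.1 * w.2.2.2, w.2.1 * w.2.2.2⟩) := rfl

lemma coneParam_two (w : ℝ × ℝ × ℝ × ℝ) : coneParam 2 w =
    (⟨w.1 * w.2.2.1 - w.2.1 * w.2.2.2, w.1 * w.2.2.2 + w.2.1 * w.2.2.1⟩,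
      ⟨w.1 * w.2.2.1 + w.2.1 * w.2.2.2, w.2.1 * w.2.2.1 - w.1 * w.2.2.2⟩) := rfl

lemma hopf_coneParam (i : Fin 3) (w : ℝ × ℝ × ℝ × ℝ) : hopf i (coneParam i w) = 0 := by
  obtain rfl | rfl | rfl := fin_three_cases i
  · simp only [hopf_zero, coneParam_zero]; ring
  · simp only [hopf_one, coneParam_one]; ring
  · simp only [hopf_two, coneParam_two]; ring

/-- Real-valued functions on `ℂ²` that are homogeneous quadratic polynomials in the four real
coordinates. -/
def IsQuadratic (q : ℂ × ℂ → ℝ) : Prop :=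
  ∃ k₀ k₁ k₂ k₃ k₄ k₅ k₆ k₇ k₈ k₉ : ℝ, ∀ v, q v =
    k₀ * v.1.re ^ 2 + k₁ * v.1.im ^ 2 + k₂ * v.2.re ^ 2 + k₃ * v.2.im ^ 2 +
    k₄ * (v.1.re * v.1.im) + k₅ * (v.1.re * v.2.re) + k₆ * (v.1.re * v.2.im) +
    k₇ * (v.1.im * v.2.re) + k₈ * (v.1.im * v.2.im) + k₉ * (v.2.re * v.2.im)

lemma map_eq_sum_basis (A : (ℂ × ℂ) ≃ₗ[ℝ] (ℂ × ℂ)) (v : ℂ × ℂ) :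
    A v = v.1.re • A (1, 0) + v.1.im • A (Complex.I, 0) + v.2.re • A (0, 1) +
      v.2.im • A (0, Complex.I) := by
  simp only [← map_smul, ← map_add]
  congr 1
  ext <;> simp

lemma isQuadratic_hopf_comp (j : Fin 3) (A : (ℂ × ℂ) ≃ₗ[ℝ] (ℂ × ℂ)) :
    IsQuadratic fun v => hopf j (A v) := by
  suffices h : IsQuadratic fun v : ℂ × ℂ => hopf j (v.1.re • A (1, 0) +
      v.1.im • A (Complex.I, 0) + v.2.re • A (0, 1) + v.2.im • A (0, Complex.I)) by
    convert h using 3; rw [← map_eq_sum_basis A]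
  generalize A (1, 0) = e₀
  generalize A (Complex.I, 0) = e₁
  generalize A (0, 1) = e₂
  generalize A (0, Complex.I) = e₃
  refine ⟨hopf j e₀, hopf j e₁, hopf j e₂, hopf j e₃, hopf j (e₀ + e₁) - hopf j e₀ - hopf j e₁,
    hopf j (e₀ + e₂) - hopf j e₀ - hopf j e₂, hopf j (e₀ + e₃) - hopf j e₀ - hopf j e₃,
    hopf j (e₁ + e₂) - hopf j e₁ - hopf j e₂, hopf j (e₁ + e₃) - hopf j e₁ - hopf j e₃,
    hopf j (e₂ + e₃) - hopf j e₂ - hopf j e₃, fun v => ?_⟩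
  obtain rfl | rfl | rfl := fin_three_cases j <;>
    simp [hopf_zero, hopf_one, hopf_two] <;> ring

lemma IsQuadratic.analyticOnNhd {q : ℂ × ℂ → ℝ} (hq : IsQuadratic q) (i : Fin 3) :
    AnalyticOnNhd ℝ (fun w => q (coneParam i w)) Set.univ := by
  obtain ⟨k₀, k₁, k₂, k₃, k₄, k₅, k₆, k₇, k₈, k₉, hq⟩ := hq
  rw [← contDiff_omega_iff_analyticOnNhd]
  simp only [hq]
  obtain rfl | rfl | rfl := fin_three_cases i <;>
    simp only [coneParam_zero, coneParam_one, coneParam_two] <;> fun_prop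

/-- A quadratic form vanishing on the cone `hopf i = 0` is a multiple of `hopf i`. -/
lemma IsQuadratic.eq_const_mul_hopf {q : ℂ × ℂ → ℝ} (hq : IsQuadratic q) (i : Fin 3)
    (h : ∀ w, q (coneParam i w) = 0) : ∃ c : ℝ, ∀ v, q v = c * hopf i v := by
  obtain ⟨k₀, k₁, k₂, k₃, k₄, k₅, k₆, k₇, k₈, k₉, hq⟩ := hq
  simp only [hq] at h ⊢
  have h1 := h (1, 0, 1, 0)
  have h2 := h (1, 0, 0, 1)
  have h3 := h (1, 0, 1, 1)
  have h4 := h (0, 1, 1, 0)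
  have h5 := h (0, 1, 0, 1)
  have h6 := h (0, 1, 1, 1)
  have h7 := h (1, 1, 1, 0)
  have h8 := h (1, 1, 0, 1)
  have h9 := h (1, 1, 1, 1)
  obtain rfl | rfl | rfl := fin_three_cases i
  · simp only [coneParam_zero] at h1 h2 h3 h4 h5 h6 h7 h8 h9
    refine ⟨k₅ / 2, fun v => ?_⟩
    rw [hopf_zero, show k₀ = 0 by linarith, show k₁ = 0 by linarith, show k₂ = 0 by linarith,
      show k₃ = 0 by linarith, show k₄ = 0 by linarith, show k₆ = 0 by linarith,
      show k₇ = 0 by linarith, show k₈ = k₅ by linarith, show k₉ = 0 by linarith]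
    ring
  · simp only [coneParam_one] at h1 h2 h3 h4 h5 h6 h7 h8 h9
    refine ⟨k₇ / 2, fun v => ?_⟩
    rw [hopf_one, show k₀ = 0 by linarith, show k₁ = 0 by linarith, show k₂ = 0 by linarith,
      show k₃ = 0 by linarith, show k₄ = 0 by linarith, show k₅ = 0 by linarith,
      show k₆ = -k₇ by linarith, show k₈ = 0 by linarith, show k₉ = 0 by linarith]
    ring
  · simp only [coneParam_two] at h1 h2 h3 h4 h5 h6 h7 h8 h9
    refine ⟨k₀, fun v => ?_⟩
    rw [hopf_two, show k₁ = k₀ by linarith, show k₂ = -k₀ by linarith,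
      show k₃ = -k₀ by linarith, show k₄ = 0 by linarith, show k₅ = 0 by linarith,
      show k₆ = 0 by linarith, show k₇ = 0 by linarith, show k₈ = 0 by linarith,
      show k₉ = 0 by linarith]
    ring

lemma AnalyticOnNhd.eq_zero_or_eq_zero_of_mul {E : Type*} [NormedAddCommGroup E]
    [NormedSpace ℝ E] {f g : E → ℝ} (hf : AnalyticOnNhd ℝ f Set.univ)
    (hg : AnalyticOnNhd ℝ g Set.univ) (hfg : ∀ w, f w * g w = 0) :
    (∀ w, f w = 0) ∨ ∀ w, g w = 0 := by
  by_contra! h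
  obtain ⟨⟨w₀, hw₀⟩, w₁, hw₁⟩ := h
  refine hw₁ (hg.eqOn_zero_of_preconnected_of_eventuallyEq_zero isPreconnected_univ
    (Set.mem_univ w₀) ?_ (Set.mem_univ w₁))
  filter_upwards [(hf w₀ (Set.mem_univ _)).continuousAt.eventually_ne hw₀] with w hw
  exact (mul_eq_zero.1 (hfg w)).resolve_left hw

lemma AnalyticOnNhd.exists_eq_zero_of_prod {E ι : Type*} [NormedAddCommGroup E]
    [NormedSpace ℝ E] {f : ι → E → ℝ} (hf : ∀ j, AnalyticOnNhd ℝ (f j) Set.univ) (S : Finset ι)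
    (h : ∀ w, ∏ j ∈ S, f j w = 0) : ∃ j ∈ S, ∀ w, f j w = 0 := by
  classical
  induction S using Finset.induction_on with
  | empty => exact absurd (h 0) (by simp)
  | insert a S ha ih =>
    simp only [Finset.prod_insert ha] at h
    obtain h' | h' := (hf a).eq_zero_or_eq_zero_of_mul
      (S.analyticOnNhd_fun_prod fun j _ => hf j) h
    · exact ⟨a, Finset.mem_insert_self a S, h'⟩
    · obtain ⟨j, hj, hj'⟩ := ih h'
      exact ⟨j, Finset.mem_insert_of_mem hj, hj'⟩

lemma prod_hopf_map_eq_zero {A : (ℂ × ℂ) ≃ₗ[ℝ] (ℂ × ℂ)} {S : Finset (Fin 3)}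
    (h : ∀ v, sqNorm v = 1 → ∏ i ∈ S, hopf i v = 0 → ∏ i ∈ S, hopf i (A v) = 0) (v : ℂ × ℂ)
    (hv : ∏ i ∈ S, hopf i v = 0) : ∏ i ∈ S, hopf i (A v) = 0 := by
  by_cases h0 : sqNorm v = 0
  · rwa [eq_zero_of_sqNorm_eq_zero h0, map_zero, ← eq_zero_of_sqNorm_eq_zero h0]
  · have hpos : 0 < sqNorm v := lt_of_le_of_ne (sqNorm_nonneg v) (Ne.symm h0)
    have ht : ((Real.sqrt (sqNorm v))⁻¹) ^ 2 = (sqNorm v)⁻¹ := by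
      rw [inv_pow, Real.sq_sqrt hpos.le]
    have := h ((Real.sqrt (sqNorm v))⁻¹ • v) (by rw [sqNorm_smul, ht, inv_mul_cancel₀ h0])
      (by simp only [hopf_smul, Finset.prod_mul_distrib, hv, mul_zero])
    simp only [map_smul, hopf_smul, Finset.prod_mul_distrib, ht, Finset.prod_const] at this
    exact (mul_eq_zero.1 this).resolve_left (pow_ne_zero _ (inv_ne_zero h0))

lemma hopf_sq_le (i : Fin 3) (v : ℂ × ℂ) : hopf i v ^ 2 ≤ sqNorm v ^ 2 := by
  have := sum_sq_hopf v
  obtain rfl | rfl | rfl := fin_three_cases i <;>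
    nlinarith [sq_nonneg (hopf 0 v), sq_nonneg (hopf 1 v), sq_nonneg (hopf 2 v)]

lemma exists_hopf_eq_sqNorm (i : Fin 3) : ∃ v, hopf i v = sqNorm v ∧ 0 < sqNorm v := by
  obtain rfl | rfl | rfl := fin_three_cases i
  · exact ⟨(1, 1), by norm_num [hopf_zero, sqNorm], by norm_num [sqNorm]⟩
  · exact ⟨(Complex.I, 1), by norm_num [hopf_one, sqNorm], by norm_num [sqNorm]⟩
  · exact ⟨(1, 0), by norm_num [hopf_two, sqNorm], by norm_num [sqNorm]⟩

lemma sq_eq_one_of_hopf_map {A : (ℂ × ℂ) ≃ₗ[ℝ] (ℂ × ℂ)} (hA : ∀ v, sqNorm (A v) = sqNorm v)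
    {i j : Fin 3} {c : ℝ} (h : ∀ v, hopf j (A v) = c * hopf i v) : c ^ 2 = 1 := by
  apply le_antisymm
  · obtain ⟨v, hv, hpos⟩ := exists_hopf_eq_sqNorm i
    have := hopf_sq_le j (A v)
    rw [h, hA, hv, mul_pow] at this
    exact le_of_mul_le_mul_right (by linarith) (pow_pos hpos 2)
  · obtain ⟨v, hv, hpos⟩ := exists_hopf_eq_sqNorm j
    obtain ⟨u, rfl⟩ := A.surjective v
    have := hopf_sq_le i u
    rw [h, hA] at hv
    rw [hA] at hpos
    refine le_of_mul_le_mul_right ?_ (pow_pos hpos 2)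
    calc 1 * sqNorm u ^ 2 = c ^ 2 * hopf i u ^ 2 := by rw [← hv]; ring
      _ ≤ c ^ 2 * sqNorm u ^ 2 := by gcongr

/-- An isometry preserving a union of cones `hopf i = 0` permutes these cones, and permutes the
corresponding `hopf i` up to sign. -/
lemma exists_perm_hopf {A : (ℂ × ℂ) ≃ₗ[ℝ] (ℂ × ℂ)} (hA : ∀ v, sqNorm (A v) = sqNorm v)
    {S : Finset (Fin 3)} (hS : ∀ v, ∏ i ∈ S, hopf i v = 0 → ∏ i ∈ S, hopf i (A v) = 0)
    {i : Fin 3} (hi : i ∈ S) :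
    ∃ j ∈ S, ∃ c : ℝ, c ^ 2 = 1 ∧ ∀ v, hopf j (A v) = c * hopf i v := by
  obtain ⟨j, hj, hj'⟩ := AnalyticOnNhd.exists_eq_zero_of_prod
    (f := fun j w => hopf j (A (coneParam i w)))
    (fun j => (isQuadratic_hopf_comp j A).analyticOnNhd i) S
    fun w => hS _ (Finset.prod_eq_zero hi (hopf_coneParam i w))
  obtain ⟨c, hc⟩ := (isQuadratic_hopf_comp j A).eq_const_mul_hopf i hj'
  exact ⟨j, hj, c, sq_eq_one_of_hopf_map hA hc, hc⟩

lemma hopf_index_injective {A : (ℂ × ℂ) ≃ₗ[ℝ] (ℂ × ℂ)} {i i' j : Fin 3} {c c' : ℝ}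
    (hc : c ^ 2 = 1) (h : ∀ v, hopf j (A v) = c * hopf i v)
    (h' : ∀ v, hopf j (A v) = c' * hopf i' v) : i = i' := by
  by_contra hne
  obtain ⟨v, hv, hpos⟩ := exists_hopf_eq_sqNorm i
  have h0 : hopf i' v = 0 := by
    have := sum_sq_hopf v
    rw [← hv] at this
    apply pow_eq_zero_iff two_ne_zero |>.1
    obtain rfl | rfl | rfl := fin_three_cases i <;> obtain rfl | rfl | rfl := fin_three_cases i' <;>
      first
      | exact absurd rfl hne
      | nlinarith [sq_nonneg (hopf 0 v), sq_nonneg (hopf 1 v), sq_nonneg (hopf 2 v)]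
  have := (h v).symm.trans (h' v)
  rw [h0, hv, mul_zero] at this
  have hc0 : c = 0 := (mul_eq_zero.1 this).resolve_right hpos.ne'
  rw [hc0] at hc
  norm_num at hc

lemma exists_linearEquiv_of_sqNorm (f : ℂ × ℂ →ₗ[ℝ] ℂ × ℂ) (hf : ∀ v, sqNorm (f v) = sqNorm v) :
    ∃ A : (ℂ × ℂ) ≃ₗ[ℝ] (ℂ × ℂ), ∀ v, A v = f v := by
  refine ⟨LinearEquiv.ofInjectiveEndo f ?_, fun v => rfl⟩
  rw [injective_iff_map_eq_zero]
  intro v hv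
  apply eq_zero_of_sqNorm_eq_zero
  rw [← hf, hv]
  simp [sqNorm]

lemma exists_phase_mem : ∃ A ∈ Subgroup.closure genSetW'2, ∀ v,
    hopf 0 (A v) = hopf 1 v ∧ hopf 1 (A v) = -hopf 0 v ∧ hopf 2 (A v) = hopf 2 v := by
  obtain ⟨A, hA⟩ := exists_linearEquiv_of_sqNorm
    { toFun := fun z => (z.1, Complex.I * z.2)
      map_add' := fun z w => by simp [mul_add]
      map_smul' := fun t z => by simp [mul_left_comm] } (fun v => by simp [sqNorm]; ring)
  refine ⟨A, Subgroup.subset_closure (Or.inl hA), fun v => ?_⟩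
  rw [hA]
  simp [hopf_zero, hopf_one, hopf_two]
  refine ⟨?_, ?_, ?_⟩ <;> ring

lemma exists_conj_mem : ∃ A ∈ Subgroup.closure genSetW'2, ∀ v,
    hopf 0 (A v) = hopf 0 v ∧ hopf 1 (A v) = -hopf 1 v ∧ hopf 2 (A v) = hopf 2 v := by
  obtain ⟨A, hA⟩ := exists_linearEquiv_of_sqNorm
    { toFun := fun z => ((starRingEnd ℂ) z.1, (starRingEnd ℂ) z.2)
      map_add' := fun z w => by simp
      map_smul' := fun t z => by simp } (fun v => by simp [sqNorm])
  refine ⟨A, Subgroup.subset_closure (Or.inr (Or.inl hA)), fun v => ?_⟩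
  rw [hA]
  simp [hopf_zero, hopf_one, hopf_two]
  ring

lemma exists_rotation_mem : ∃ A ∈ Subgroup.closure genSetW'2, ∀ v,
    hopf 0 (A v) = hopf 0 v ∧ hopf 1 (A v) = hopf 2 v ∧ hopf 2 (A v) = -hopf 1 v := by
  obtain ⟨A, hA⟩ := exists_linearEquiv_of_sqNorm
    { toFun := fun z => ((z.1 + z.2) / 2 + Complex.I * (z.1 - z.2) / 2,
                (z.1 + z.2) / 2 - Complex.I * (z.1 - z.2) / 2)
      map_add' := fun z w => by ext1 <;> simp <;> ring
      map_smul' := fun t z => by ext1 <;> simp <;> ring } (fun v => by simp [sqNorm]; ring)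
  refine ⟨A, Subgroup.subset_closure (Or.inr (Or.inr (Or.inl hA))), fun v => ?_⟩
  rw [hA]
  simp [hopf_zero, hopf_one, hopf_two]
  refine ⟨?_, ?_, ?_⟩ <;> ring

/-- Every element of the group is an isometry permuting the `hopf i` up to sign, so it preserves
the square of their product. -/
lemma preserves_of_mem_closure {A : (ℂ × ℂ) ≃ₗ[ℝ] (ℂ × ℂ)}
    (hA : A ∈ Subgroup.closure genSetW'2) :
    (∀ v, sqNorm (A v) = sqNorm v) ∧ ∀ v, (∏ i, hopf i (A v)) ^ 2 = (∏ i, hopf i v) ^ 2 := by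
  induction hA using Subgroup.closure_induction with
  | mem A hA =>
    obtain hA | hA | hA | ⟨α, hA⟩ := hA
    · constructor <;> intro v <;>
        simp [hA, sqNorm, Fin.prod_univ_three, hopf_zero, hopf_one, hopf_two] <;> ring
    · constructor <;> intro v <;>
        simp [hA, sqNorm, Fin.prod_univ_three, hopf_zero, hopf_one, hopf_two]; ring
    · constructor <;> intro v <;>
        simp [hA, sqNorm, Fin.prod_univ_three, hopf_zero, hopf_one, hopf_two] <;> ring
    · have hα := Real.sin_sq_add_cos_sq α
      have h0 (v) : hopf 0 (A v) = hopf 0 v := by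
        simp only [hA, hopf_zero, Complex.mul_re, Complex.mul_im, re_exp_mul_I, im_exp_mul_I]
        linear_combination 2 * (v.1.re * v.2.re + v.1.im * v.2.im) * hα
      have h1 (v) : hopf 1 (A v) = hopf 1 v := by
        simp only [hA, hopf_one, Complex.mul_re, Complex.mul_im, re_exp_mul_I, im_exp_mul_I]
        linear_combination 2 * (v.1.im * v.2.re - v.1.re * v.2.im) * hα
      have h2 (v) : hopf 2 (A v) = hopf 2 v := by
        simp only [hA, hopf_two, Complex.mul_re, Complex.mul_im, re_exp_mul_I, im_exp_mul_I]
        linear_combination (v.1.re ^ 2 + v.1.im ^ 2 - v.2.re ^ 2 - v.2.im ^ 2) * hα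
      refine ⟨fun v => ?_, fun v => by simp only [Fin.prod_univ_three, h0, h1, h2]⟩
      simp only [hA, sqNorm, Complex.mul_re, Complex.mul_im, re_exp_mul_I, im_exp_mul_I]
      linear_combination (v.1.re ^ 2 + v.1.im ^ 2 + v.2.re ^ 2 + v.2.im ^ 2) * hα
  | one => exact ⟨fun v => rfl, fun v => rfl⟩
  | mul A B _ _ hA hB =>
    exact ⟨fun v => (hA.1 _).trans (hB.1 v), fun v => (hA.2 _).trans (hB.2 v)⟩
  | inv A _ hA =>
    have h (v) : A (A⁻¹ v) = v := A.apply_symm_apply v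
    exact ⟨fun v => by rw [← hA.1, h], fun v => by rw [← hA.2, h]⟩

/-- The only isometries over the identity of the Hopf base are the Hopf rotations. -/
lemma mem_closure_of_hopf_eq {A : (ℂ × ℂ) ≃ₗ[ℝ] (ℂ × ℂ)} (hA : ∀ v, sqNorm (A v) = sqNorm v)
    (h : ∀ i v, hopf i (A v) = hopf i v) : A ∈ Subgroup.closure genSetW'2 := by
  have hfst (z : ℂ) : (A (z, 0)).2 = 0 := by
    have h1 := hA (z, 0)
    have h2 := h 2 (z, 0)
    simp only [sqNorm, hopf_two, Complex.zero_re, Complex.zero_im] at h1 h2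
    apply Complex.ext <;> simp only [Complex.zero_re, Complex.zero_im] <;>
      nlinarith [sq_nonneg (A (z, 0)).2.re, sq_nonneg (A (z, 0)).2.im]
  have hsnd (z : ℂ) : (A (0, z)).1 = 0 := by
    have h1 := hA (0, z)
    have h2 := h 2 (0, z)
    simp only [sqNorm, hopf_two, Complex.zero_re, Complex.zero_im] at h1 h2
    apply Complex.ext <;> simp only [Complex.zero_re, Complex.zero_im] <;>
      nlinarith [sq_nonneg (A (0, z)).1.re, sq_nonneg (A (0, z)).1.im]
  have hadd (z w : ℂ) : A (z, w) = ((A (z, 0)).1, (A (0, w)).2) := by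
    rw [show (z, w) = (z, 0) + (0, w) by simp, map_add]
    ext1 <;> simp [hfst, hsnd]
  have hre (z w : ℂ) : (A (z, 0)).1.re * (A (0, w)).2.re + (A (z, 0)).1.im * (A (0, w)).2.im =
      z.re * w.re + z.im * w.im := by
    have := h 0 (z, w)
    simp only [hopf_zero, hadd z w] at this
    linarith
  have him (z w : ℂ) : (A (z, 0)).1.im * (A (0, w)).2.re - (A (z, 0)).1.re * (A (0, w)).2.im =
      z.im * w.re - z.re * w.im := by
    have := h 1 (z, w)
    simp only [hopf_one, hadd z w] at this
    linarith
  set u := (A (1, 0)).1 with hu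
  have hu1 : u.re ^ 2 + u.im ^ 2 = 1 := by
    have h1 := hA (1, 0)
    simpa [sqNorm, hfst, ← hu] using h1
  have hw (w : ℂ) : (A (0, w)).2 = u * w := by
    have h1 := hre 1 w
    have h2 := him 1 w
    rw [← hu] at h1 h2
    simp only [Complex.one_re, Complex.one_im] at h1 h2
    apply Complex.ext <;> simp only [Complex.mul_re, Complex.mul_im]
    · linear_combination u.re * h1 + u.im * h2 - (A (0, w)).2.re * hu1
    · linear_combination u.im * h1 - u.re * h2 - (A (0, w)).2.im * hu1
  have hz (z : ℂ) : (A (z, 0)).1 = u * z := by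
    have h1 := hre z 1
    have h2 := him z 1
    rw [hw, mul_one] at h1 h2
    simp only [Complex.one_re, Complex.one_im] at h1 h2
    apply Complex.ext <;> simp only [Complex.mul_re, Complex.mul_im]
    · linear_combination u.re * h1 - u.im * h2 - (A (z, 0)).1.re * hu1
    · linear_combination u.im * h1 + u.re * h2 - (A (z, 0)).1.im * hu1
  obtain ⟨α, hα, hα'⟩ := exists_cos_sin hu1
  have huα : u = Complex.exp ((α : ℂ) * Complex.I) := by
    apply Complex.ext
    · rw [re_exp_mul_I, hα]
    · rw [im_exp_mul_I, hα']
  refine Subgroup.subset_closure (Or.inr (Or.inr (Or.inr ⟨α, fun v => ?_⟩)))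
  rw [← huα, ← hz, ← hw, ← hadd]

lemma exists_sign_mem_single (i : Fin 3) : ∃ D ∈ Subgroup.closure genSetW'2,
    ∀ k v, hopf k (D v) = (if k = i then -1 else 1) * hopf k v := by
  obtain ⟨C, hC, hC'⟩ := exists_conj_mem
  obtain rfl | rfl | rfl := fin_three_cases i
  · obtain ⟨B, hB, hB'⟩ := exists_phase_mem
    refine ⟨B * B * C, mul_mem (mul_mem hB hB) hC, fun k v => ?_⟩
    obtain rfl | rfl | rfl := fin_three_cases k <;> simp [LinearEquiv.mul_apply, hB', hC']
  · refine ⟨C, hC, fun k v => ?_⟩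
    obtain rfl | rfl | rfl := fin_three_cases k <;> simp [hC']
  · obtain ⟨B, hB, hB'⟩ := exists_rotation_mem
    refine ⟨B * B * C, mul_mem (mul_mem hB hB) hC, fun k v => ?_⟩
    obtain rfl | rfl | rfl := fin_three_cases k <;> simp [LinearEquiv.mul_apply, hB', hC']

lemma exists_sign_mem {c : Fin 3 → ℝ} (hc : ∀ i, c i ^ 2 = 1) :
    ∃ D ∈ Subgroup.closure genSetW'2, ∀ k v, hopf k (D v) = c k * hopf k v := by
  have key (i : Fin 3) : ∃ D ∈ Subgroup.closure genSetW'2,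
      ∀ k v, hopf k (D v) = (if k = i then c i else 1) * hopf k v := by
    obtain h | h := mul_self_eq_one_iff.1 ((sq (c i)).symm.trans (hc i))
    · exact ⟨1, one_mem _, fun k v => by simp [h]⟩
    · rw [h]; exact exists_sign_mem_single i
  choose D hD hD' using key
  refine ⟨D 0 * D 1 * D 2, mul_mem (mul_mem (hD 0) (hD 1)) (hD 2), fun k v => ?_⟩
  obtain rfl | rfl | rfl := fin_three_cases k <;> simp [LinearEquiv.mul_apply, hD']

lemma exists_perm_mem (σ : Equiv.Perm (Fin 3)) : ∃ B ∈ Subgroup.closure genSetW'2,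
    ∃ c : Fin 3 → ℝ, (∀ i, c i ^ 2 = 1) ∧ ∀ i v, hopf (σ i) (B v) = c i * hopf i v := by
  have hmul {σ τ : Equiv.Perm (Fin 3)}
      (hσ : ∃ B ∈ Subgroup.closure genSetW'2,
        ∃ c : Fin 3 → ℝ, (∀ i, c i ^ 2 = 1) ∧ ∀ i v, hopf (σ i) (B v) = c i * hopf i v)
      (hτ : ∃ B ∈ Subgroup.closure genSetW'2,
        ∃ c : Fin 3 → ℝ, (∀ i, c i ^ 2 = 1) ∧ ∀ i v, hopf (τ i) (B v) = c i * hopf i v) :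
      ∃ B ∈ Subgroup.closure genSetW'2, ∃ c : Fin 3 → ℝ, (∀ i, c i ^ 2 = 1) ∧
        ∀ i v, hopf ((σ * τ) i) (B v) = c i * hopf i v := by
    obtain ⟨B, hB, c, hc, h⟩ := hσ
    obtain ⟨B', hB', c', hc', h'⟩ := hτ
    refine ⟨B * B', mul_mem hB hB', fun i => c (τ i) * c' i,
      fun i => by rw [mul_pow, hc, hc', one_mul], fun i v => ?_⟩
    rw [LinearEquiv.mul_apply, Equiv.Perm.mul_apply, h, h', mul_assoc]
  have h1 : ∃ B ∈ Subgroup.closure genSetW'2, ∃ c : Fin 3 → ℝ, (∀ i, c i ^ 2 = 1) ∧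
      ∀ i v, hopf ((1 : Equiv.Perm (Fin 3)) i) (B v) = c i * hopf i v :=
    ⟨1, one_mem _, 1, fun i => one_pow 2, fun i v => by simp⟩
  have hs : ∃ B ∈ Subgroup.closure genSetW'2, ∃ c : Fin 3 → ℝ, (∀ i, c i ^ 2 = 1) ∧
      ∀ i v, hopf (Equiv.swap 0 1 i) (B v) = c i * hopf i v := by
    obtain ⟨B, hB, hB'⟩ := exists_phase_mem
    refine ⟨B, hB, ![-1, 1, 1], fun i => ?_, fun i v => ?_⟩
    · obtain rfl | rfl | rfl := fin_three_cases i <;> simp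
    · obtain rfl | rfl | rfl := fin_three_cases i <;>
        simp [hB', Equiv.swap_apply_of_ne_of_ne]
  have ht : ∃ B ∈ Subgroup.closure genSetW'2, ∃ c : Fin 3 → ℝ, (∀ i, c i ^ 2 = 1) ∧
      ∀ i v, hopf (Equiv.swap 1 2 i) (B v) = c i * hopf i v := by
    obtain ⟨B, hB, hB'⟩ := exists_rotation_mem
    refine ⟨B, hB, ![1, -1, 1], fun i => ?_, fun i v => ?_⟩
    · obtain rfl | rfl | rfl := fin_three_cases i <;> simp
    · obtain rfl | rfl | rfl := fin_three_cases i <;>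
        simp [hB', Equiv.swap_apply_of_ne_of_ne]
  have hcases : ∀ σ : Equiv.Perm (Fin 3), σ = 1 ∨ σ = Equiv.swap 0 1 ∨ σ = Equiv.swap 1 2 ∨
      σ = Equiv.swap 0 1 * Equiv.swap 1 2 ∨ σ = Equiv.swap 1 2 * Equiv.swap 0 1 ∨
      σ = Equiv.swap 0 1 * Equiv.swap 1 2 * Equiv.swap 0 1 := by decide
  obtain rfl | rfl | rfl | rfl | rfl | rfl := hcases σ
  exacts [h1, hs, ht, hmul hs ht, hmul ht hs, hmul (hmul hs ht) hs]

lemma mem_closure_of_preserves {A : (ℂ × ℂ) ≃ₗ[ℝ] (ℂ × ℂ)} (hA : ∀ v, sqNorm (A v) = sqNorm v)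
    (h : ∀ v, ∏ i, hopf i v = 0 → ∏ i, hopf i (A v) = 0) :
    A ∈ Subgroup.closure genSetW'2 := by
  choose j _ c hc hj using fun i => exists_perm_hopf hA h (Finset.mem_univ i)
  have hinj : Function.Injective j := fun i i' hii' =>
    hopf_index_injective (hc i) (hj i) fun v => by rw [hii', hj]
  set σ := Equiv.ofBijective j (Finite.injective_iff_bijective.1 hinj)
  obtain ⟨B, hB, d, hd, hBd⟩ := exists_perm_mem σ⁻¹
  obtain ⟨D, hD, hD'⟩ := exists_sign_mem (c := fun i => d (j i) * c i)
    fun i => by rw [mul_pow, hd, hc, one_mul]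
  rw [← Subgroup.mul_mem_cancel_left _ hB, ← Subgroup.mul_mem_cancel_left _ hD]
  refine mem_closure_of_hopf_eq (fun v => ?_) fun i v => ?_
  · rw [LinearEquiv.mul_apply, LinearEquiv.mul_apply, (preserves_of_mem_closure hD).1,
      (preserves_of_mem_closure hB).1, hA]
  · have hi : σ⁻¹ (j i) = i := σ.symm_apply_apply i
    have := hBd (j i) (A v)
    rw [hi, hj] at this
    rw [LinearEquiv.mul_apply, LinearEquiv.mul_apply, hD', this]
    linear_combination (c i ^ 2 * hopf i v) * hd (j i) + hopf i v * hc i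

lemma image_eq_of_mem_iff (A : (ℂ × ℂ) ≃ₗ[ℝ] (ℂ × ℂ)) {W : Set (ℂ × ℂ)}
    (h : ∀ v, A v ∈ W ↔ v ∈ W) : A '' W = W := by
  conv_lhs => rw [show W = A ⁻¹' W from Set.ext fun v => (h v).symm]
  exact Set.image_preimage_eq W A.surjective

/-- An isometry preserving the cone over `T₁ ∪ T₂` also preserves the cone over the
remaining Clifford torus. -/
lemma prod_hopf_map_eq_zero_of_pair {A : (ℂ × ℂ) ≃ₗ[ℝ] (ℂ × ℂ)}
    (hA : ∀ v, sqNorm (A v) = sqNorm v)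
    (h : ∀ v, ∏ i ∈ {0, 1}, hopf i v = 0 → ∏ i ∈ {0, 1}, hopf i (A v) = 0) (v : ℂ × ℂ)
    (hv : ∏ i, hopf i v = 0) : ∏ i, hopf i (A v) = 0 := by
  obtain ⟨j, hj, c, hc, hjc⟩ := exists_perm_hopf hA h (i := 0) (by simp)
  obtain ⟨j', hj', c', hc', hjc'⟩ := exists_perm_hopf hA h (i := 1) (by simp)
  have hne : j ≠ j' := by
    rintro rfl
    exact absurd (hopf_index_injective hc hjc hjc') (by decide)
  have e : hopf j (A v) ^ 2 = hopf 0 v ^ 2 := by rw [hjc, mul_pow, hc, one_mul]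
  have e' : hopf j' (A v) ^ 2 = hopf 1 v ^ 2 := by rw [hjc', mul_pow, hc', one_mul]
  have hsum := sum_sq_hopf (A v)
  rw [hA, ← sum_sq_hopf v] at hsum
  have hsq : (∏ i, hopf i (A v)) ^ 2 = (∏ i, hopf i v) ^ 2 := by
    simp only [Finset.mem_insert, Finset.mem_singleton] at hj hj'
    simp only [Fin.prod_univ_three, mul_pow]
    obtain rfl | rfl := hj <;> obtain rfl | rfl := hj'
    · exact absurd rfl hne
    · rw [e, e', show hopf 2 (A v) ^ 2 = hopf 2 v ^ 2 by linarith]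
    · rw [e, e', show hopf 2 (A v) ^ 2 = hopf 2 v ^ 2 by linarith, mul_comm (hopf 1 v ^ 2)]
    · exact absurd rfl hne
  rw [hv] at hsq
  exact (pow_eq_zero_iff two_ne_zero).1 (by rw [hsq]; norm_num)

/-- The stabilizer in `O(4)` of `𝒲'₂ = T₁ ∪ T₂ ∪ T'` is the subgroup generated by the four
listed families, and this group properly contains the stabilizer in `O(4)` of
`𝒲₂ = T₁ ∪ T₂`. -/
theorem stabilizer_of_W'2 :
    {A : (ℂ × ℂ) ≃ₗ[ℝ] (ℂ × ℂ) |
      (∀ v w : ℂ × ℂ, realInner (A v) (A w) = realInner v w) ∧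
        ⇑A '' (torusT1 ∪ torusT2 ∪ cliffordT') = torusT1 ∪ torusT2 ∪ cliffordT'} =
      ↑(Subgroup.closure genSetW'2) ∧
    {A : (ℂ × ℂ) ≃ₗ[ℝ] (ℂ × ℂ) |
      (∀ v w : ℂ × ℂ, realInner (A v) (A w) = realInner v w) ∧
        ⇑A '' (torusT1 ∪ torusT2) = torusT1 ∪ torusT2} ⊂
      ↑(Subgroup.closure genSetW'2) := by

  constructor
  · ext A
    constructor
    · rintro ⟨hA, hW⟩
      rw [isometry_iff] at hA
      refine mem_closure_of_preserves hA (prod_hopf_map_eq_zero fun v hv hv' => ?_)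
      exact ((mem_W'_iff _).1 (hW ▸ Set.mem_image_of_mem A ((mem_W'_iff v).2 ⟨hv, hv'⟩))).2
    · intro hA
      obtain ⟨h, h'⟩ := preserves_of_mem_closure hA
      refine ⟨(isometry_iff A).2 h, image_eq_of_mem_iff A fun v => ?_⟩
      rw [mem_W'_iff, mem_W'_iff, h, ← pow_eq_zero_iff two_ne_zero, h',
        pow_eq_zero_iff two_ne_zero]
  · rw [Set.ssubset_iff_of_subset]
    · obtain ⟨R, hR, hR'⟩ := exists_rotation_mem
      refine ⟨R, hR, fun ⟨_, hW⟩ => ?_⟩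
      have hv : (((3 / 5 : ℝ) : ℂ), ((4 / 5 : ℝ) : ℂ)) ∈ torusT1 ∪ torusT2 := by
        rw [mem_W_iff]
        norm_num [sqNorm, hopf_zero, hopf_one]
      have hRv := ((mem_W_iff _).1 (hW ▸ Set.mem_image_of_mem R hv)).2
      rw [Finset.prod_pair zero_ne_one, (hR' _).1, (hR' _).2.1] at hRv
      norm_num [hopf_zero, hopf_two] at hRv
    · rintro A ⟨hA, hW⟩
      rw [isometry_iff] at hA
      refine mem_closure_of_preserves hA (prod_hopf_map_eq_zero_of_pair hA
        (prod_hopf_map_eq_zero fun v hv hv' => ?_))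
      exact ((mem_W_iff _).1 (hW ▸ Set.mem_image_of_mem A ((mem_W_iff v).2 ⟨hv, hv'⟩))).2
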